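/- Let P₁, …, P_m ⊆ ℝ^d (d ≥ 1, m ≥ 1) be polytopes in general position, each of dimension at least 1 (equivalently, each having at least 2 vertices). Then the Minkowski sum P₁ + ⋯ + P_m has at least 2·Σ_{k=0}^{d−1} C(m−1, k) extreme points, i.e. at least as many vertices as a Minkowski sum of m line segments in general position in ℝ^d. -/

import Mathlib

open Pointwise

/-- A polytope in `ℝ^d`: the convex hull of a nonempty finite set of points. -/
def IsPolytope {d : ℕ} (P : Set (Fin d → ℝ)) : Prop :=
  ∃ S : Finset (Fin d → ℝ), S.Nonempty ∧ P = convexHull ℝ (S : Set (Fin d → ℝ))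

/-- The dimension of a convex set: the rank of the direction of its affine span. -/
noncomputable def polyDim {d : ℕ} (P : Set (Fin d → ℝ)) : ℕ :=
  Module.finrank ℝ ↥(vectorSpan ℝ P)

/-- The face of `P` in the direction of the linear functional `c`. -/
def face {d : ℕ} (c : (Fin d → ℝ) →ₗ[ℝ] ℝ) (P : Set (Fin d → ℝ)) : Set (Fin d → ℝ) :=
  {x ∈ P | ∀ y ∈ P, c y ≤ c x}

/-- Polytopes `P₁, …, P_m` are in general position if for every nonzero linear functional `c`,
the dimension of the Minkowski sum of the faces `F^c(Pᵢ)` equals the sum of their dimensions. -/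
def InGeneralPosition {d m : ℕ} (P : Fin m → Set (Fin d → ℝ)) : Prop :=
  ∀ c : (Fin d → ℝ) →ₗ[ℝ] ℝ, c ≠ 0 →
    polyDim (∑ i, face c (P i)) = ∑ i, polyDim (face c (P i))

/-- The points of the finite set `S` at which the functional `c` is maximal on `S`. -/
noncomputable def maximizers {E : Type*} [NormedAddCommGroup E] [NormedSpace ℝ E]
    (c : StrongDual ℝ E) (S : Finset E) : Finset E :=
  open Classical in S.filter fun x => ∀ y ∈ S, c y ≤ c x

section Maximizers

variable {E : Type*} [NormedAddCommGroup E] [NormedSpace ℝ E]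

theorem mem_maximizers {c : StrongDual ℝ E} {S : Finset E} {x : E} :
    x ∈ maximizers c S ↔ x ∈ S ∧ ∀ y ∈ S, c y ≤ c x := by
  simp [maximizers]

theorem maximizers_subset (c : StrongDual ℝ E) (S : Finset E) : maximizers c S ⊆ S :=
  fun _ hx => (mem_maximizers.1 hx).1

theorem maximizers_nonempty (c : StrongDual ℝ E) {S : Finset E} (hS : S.Nonempty) :
    (maximizers c S).Nonempty := by
  obtain ⟨x, hx, h⟩ := S.exists_max_image c hS
  exact ⟨x, mem_maximizers.2 ⟨hx, h⟩⟩

theorem maximizers_zero (S : Finset E) : maximizers (0 : StrongDual ℝ E) S = S := by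
  ext x; simp [mem_maximizers]

theorem apply_eq_of_mem_maximizers {c : StrongDual ℝ E} {S : Finset E} {a b : E}
    (ha : a ∈ maximizers c S) (hb : b ∈ maximizers c S) : c a = c b :=
  le_antisymm ((mem_maximizers.1 hb).2 a (maximizers_subset _ _ ha))
    ((mem_maximizers.1 ha).2 b (maximizers_subset _ _ hb))

theorem maximizers_smul (c : StrongDual ℝ E) (S : Finset E) {t : ℝ} (ht : 0 < t) :
    maximizers (t • c) S = maximizers c S := by
  ext x
  simp [mem_maximizers, mul_le_mul_iff_right₀ ht]

theorem apply_lt_of_maximizers_eq_singleton {c : StrongDual ℝ E} {S : Finset E} {v w : E}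
    (h : maximizers c S = {v}) (hw : w ∈ S) (hne : w ≠ v) : c w < c v := by
  have hv := mem_maximizers.1 (h ▸ Finset.mem_singleton_self v)
  refine lt_of_le_of_ne (hv.2 w hw) fun e => hne ?_
  rw [← Finset.mem_singleton, ← h, mem_maximizers]
  exact ⟨hw, fun y hy => e ▸ hv.2 y hy⟩

/-- Maximizers of a small perturbation of `c` in the direction `y` are found lexicographically. -/
theorem eventually_maximizers_add_smul (c y : StrongDual ℝ E) (S : Finset E) :
    ∀ᶠ ε in nhdsWithin (0 : ℝ) (Set.Ioi 0),
      maximizers (c + ε • y) S = maximizers y (maximizers c S) := by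
  have key : ∀ᶠ ε in nhdsWithin (0 : ℝ) (Set.Ioi 0), ∀ a ∈ S, ∀ b ∈ S, c a < c b →
      (c + ε • y) a < (c + ε • y) b := by
    refine (Finset.eventually_all S).2 fun a _ => (Finset.eventually_all S).2 fun b _ => ?_
    by_cases h : c a < c b
    · have : ∀ᶠ ε in nhds (0 : ℝ), (c + ε • y) a < (c + ε • y) b := by
        refine ContinuousAt.eventually_lt (by simp; fun_prop) (by simp; fun_prop) (by simpa)
      filter_upwards [nhdsWithin_le_nhds this] with ε hε _ using hε
    · exact Filter.Eventually.of_forall fun _ h' => absurd h' h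
  filter_upwards [key, self_mem_nhdsWithin] with ε hε hpos
  have hpos : 0 < ε := hpos
  ext x
  simp only [mem_maximizers]
  constructor
  · rintro ⟨hx, h⟩
    have hc : ∀ b ∈ S, c b ≤ c x := fun b hb => by
      by_contra hlt
      exact absurd (hε x hx b hb (not_le.1 hlt)) (not_lt.2 (h b hb))
    refine ⟨⟨hx, hc⟩, fun b hb => ?_⟩
    have h1 := h b hb.1
    have h2 := le_antisymm (hc b hb.1) (hb.2 x hx)
    simp only [add_apply, smul_apply, smul_eq_mul, h2] at h1
    nlinarith
  · rintro ⟨⟨hx, hc⟩, h⟩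
    refine ⟨hx, fun b hb => ?_⟩
    rcases (hc b hb).lt_or_eq with hlt | heq
    · exact (hε b hb x hx hlt).le
    · have := h b ⟨hb, fun z hz => heq ▸ hc z hz⟩
      simp only [add_apply, smul_apply, smul_eq_mul, heq]
      nlinarith

/-- The directions in which all polytopes with vertices `S j`, `j ∈ J`, have a positive-dimensional
face. -/
def commonWall {ι : Type*} (S : ι → Finset E) (J : Finset ι) : Set (StrongDual ℝ E) :=
  {c | ∀ j ∈ J, (maximizers c (S j)).Nontrivial}

theorem isClosed_setOf_mem_maximizers (S : Finset E) (x : E) :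
    IsClosed {c : StrongDual ℝ E | x ∈ maximizers c S} := by
  by_cases hx : x ∈ S
  · simp only [mem_maximizers, hx, true_and, Set.ofPred_forall]
    exact isClosed_iInter fun y => isClosed_iInter fun _ =>
      isClosed_le (by fun_prop) (by fun_prop)
  · simp [mem_maximizers, hx]

theorem isClosed_commonWall {ι : Type*} (S : ι → Finset E) (J : Finset ι) :
    IsClosed (commonWall S J) := by
  have : commonWall S J = ⋂ j ∈ J, ⋃ a ∈ (S j : Set E), ⋃ b ∈ (S j : Set E) \ {a},
      {c : StrongDual ℝ E | a ∈ maximizers c (S j)} ∩ {c | b ∈ maximizers c (S j)} := by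
    ext c
    simp only [commonWall, Set.mem_ofPred_eq, Set.mem_iInter, Set.mem_iUnion, Set.mem_inter_iff,
      exists_prop]
    refine forall₂_congr fun j _ => ⟨?_, ?_⟩
    · rintro ⟨a, ha, b, hb, hab⟩
      exact ⟨a, maximizers_subset _ _ ha, b, ⟨maximizers_subset _ _ hb, fun h => hab h.symm⟩,
        ha, hb⟩
    · rintro ⟨a, _, b, hb, h1, h2⟩
      exact ⟨a, h1, b, h2, fun h => hb.2 h.symm⟩
  rw [this]
  refine isClosed_biInter fun j _ => (S j).finite_toSet.isClosed_biUnion fun a _ =>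
    ((S j).finite_toSet.subset Set.sdiff_subset).isClosed_biUnion fun b _ => ?_
  exact (isClosed_setOf_mem_maximizers _ _).inter (isClosed_setOf_mem_maximizers _ _)

theorem smul_mem_commonWall {ι : Type*} {S : ι → Finset E} {J : Finset ι} {c : StrongDual ℝ E}
    (hc : c ∈ commonWall S J) {t : ℝ} (ht : 0 < t) : t • c ∈ commonWall S J := fun j hj => by
  rw [maximizers_smul _ _ ht]; exact hc j hj

end Maximizers

section Functionals

variable {E : Type*} [NormedAddCommGroup E] [NormedSpace ℝ E] [FiniteDimensional ℝ E]

theorem exists_strongDual_eq_one_of_notMem {W : Submodule ℝ E} {z : E} (hz : z ∉ W) :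
    ∃ y : StrongDual ℝ E, (∀ w ∈ W, y w = 0) ∧ y z = 1 := by
  obtain ⟨f, hf, hW⟩ := Submodule.exists_le_ker_of_notMem hz
  refine ⟨LinearMap.toContinuousLinearMap ((f z)⁻¹ • f), fun w hw => ?_, ?_⟩
  · simp [LinearMap.mem_ker.1 (hW hw)]
  · simp [inv_mul_cancel₀ hf]

/-- A functional vanishing on `W` that separates the points of a finite set whose differences
avoid `W`. -/
theorem exists_strongDual_injOn {W : Submodule ℝ E} (T : Finset E)
    (hT : ∀ a ∈ T, ∀ b ∈ T, a ≠ b → a - b ∉ W) :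
    ∃ y : StrongDual ℝ E, (∀ w ∈ W, y w = 0) ∧ Set.InjOn y T := by
  obtain ⟨f, hf⟩ := Module.exists_dual_forall_apply_ne_zero (K := ℝ)
    (fun p : {p : T × T // (p.1 : E) ≠ p.2} => W.mkQ ((p.1.1 : E) - p.1.2)) fun p => by
      rw [Submodule.mkQ_apply, Ne, Submodule.Quotient.mk_eq_zero]
      exact hT _ p.1.1.2 _ p.1.2.2 p.2
  refine ⟨LinearMap.toContinuousLinearMap (f ∘ₗ W.mkQ), fun w hw => ?_, fun a ha b hb h => ?_⟩
  · simp [(Submodule.Quotient.mk_eq_zero W).2 hw]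
  · by_contra hab
    refine hf ⟨(⟨a, ha⟩, ⟨b, hb⟩), hab⟩ ?_
    rw [map_sub, map_sub, sub_eq_zero]
    exact h

/-- If `z` is not parallel to a difference of points of `T` modulo `W`, some functional vanishing on
`W` and positive at `z` has several maximizers on `T`. -/
theorem exists_nontrivial_maximizers {W : Submodule ℝ E} {z : E} {T : Finset E}
    (hT : T.Nontrivial) (hW : ∀ a ∈ T, ∀ b ∈ T, a ≠ b → a - b ∉ W)
    (hz : ∀ a ∈ T, ∀ b ∈ T, a ≠ b → z ∉ W ⊔ Submodule.span ℝ {a - b}) :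
    ∃ y : StrongDual ℝ E, (∀ w ∈ W, y w = 0) ∧ 0 < y z ∧ (maximizers y T).Nontrivial := by
  obtain ⟨a, ha, b, hb, hab⟩ := id hT
  obtain ⟨y₀, hy₀, hy₀z⟩ := exists_strongDual_eq_one_of_notMem
    (fun h => hz a ha b hb hab (Submodule.mem_sup_left h) : z ∉ W)
  obtain ⟨v, hv⟩ := maximizers_nonempty y₀ ⟨a, ha⟩
  rw [mem_maximizers] at hv
  obtain ⟨w, hw, hwv⟩ := hT.exists_ne v
  have hsep : w - v ∉ W ⊔ Submodule.span ℝ {z} := by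
    intro h
    obtain ⟨p, hp, q, hq, hpq⟩ := Submodule.mem_sup.1 h
    obtain ⟨r, rfl⟩ := Submodule.mem_span_singleton.1 hq
    rcases eq_or_ne r 0 with rfl | hr
    · exact hW w hw v hv.1 hwv (by rw [← hpq]; simpa using hp)
    · refine hz w hw v hv.1 hwv (Submodule.mem_sup.2 ⟨-(r⁻¹ • p), W.neg_mem (W.smul_mem _ hp),
        r⁻¹ • (w - v), Submodule.smul_mem _ _ (Submodule.mem_span_singleton_self _), ?_⟩)
      rw [← hpq, smul_add, smul_smul, inv_mul_cancel₀ hr]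
      simp
  obtain ⟨y₁, hy₁, hy₁w⟩ := exists_strongDual_eq_one_of_notMem hsep
  have hy₁z : y₁ z = 0 := hy₁ z (Submodule.mem_sup_right (Submodule.mem_span_singleton_self _))
  obtain ⟨b, hb, hmin⟩ := (T.filter fun b => 0 < y₁ (b - v)).exists_min_image
    (fun b => y₀ (v - b) / y₁ (b - v)) ⟨w, Finset.mem_filter.2 ⟨hw, hy₁w ▸ one_pos⟩⟩
  rw [Finset.mem_filter] at hb
  set t := y₀ (v - b) / y₁ (b - v) with ht
  have ht0 : 0 ≤ t := div_nonneg (by simpa using hv.2 b hb.1) hb.2.le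
  have hle : ∀ x ∈ T, (y₀ + t • y₁) x ≤ (y₀ + t • y₁) v := fun x hx => by
    have h0 := hv.2 x hx
    simp only [add_apply, smul_apply, smul_eq_mul]
    rcases le_or_gt (y₁ (x - v)) 0 with h | h
    · rw [map_sub] at h
      nlinarith
    · have := hmin x (Finset.mem_filter.2 ⟨hx, h⟩)
      rw [le_div_iff₀ h, map_sub, map_sub] at this
      linarith
  have hbv : (y₀ + t • y₁) b = (y₀ + t • y₁) v := by
    have : t * y₁ (b - v) = y₀ (v - b) := div_mul_cancel₀ _ hb.2.ne'
    rw [map_sub, map_sub] at this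
    simp only [add_apply, smul_apply, smul_eq_mul]
    linarith
  refine ⟨y₀ + t • y₁, fun x hx => ?_, ?_, v, mem_maximizers.2 ⟨hv.1, hle⟩, b,
    mem_maximizers.2 ⟨hb.1, fun x hx => hbv ▸ hle x hx⟩, ?_⟩
  · simp [hy₀ x hx, hy₁ x (Submodule.mem_sup_left hx)]
  · simp [hy₀z, hy₁z]
  · rintro rfl
    simp at hb

/-- Every neighbourhood meets the complement of finitely many proper subspaces. -/
theorem frequently_forall_notMem_submodule {κ : Type*} [Finite κ] (V : κ → Submodule ℝ E)
    (hV : ∀ k, V k ≠ ⊤) (u : E) : ∃ᶠ z in nhds u, ∀ k, z ∉ V k := by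
  have : Dense (⋂ k, ((V k : Set E)ᶜ)) := by
    refine dense_iInter_of_isOpen (fun k => (V k).closed_of_finiteDimensional.isOpen_compl)
      fun k => ?_
    rw [← interior_eq_empty_iff_dense_compl]
    by_contra h
    exact hV k ((V k).eq_top_of_nonempty_interior' (Set.nonempty_iff_ne_empty.2 h))
  have := mem_closure_iff_frequently.1 (this u)
  simpa using this

/-- Negativity of an evaluation on a closed cone of functionals is an open condition. -/
theorem eventually_forall_apply_neg {C : Set (StrongDual ℝ E)} (hC : IsClosed C)
    (hcone : ∀ c ∈ C, ∀ t : ℝ, 0 < t → t • c ∈ C) {u : E} (hu : ∀ c ∈ C, c ≠ 0 → c u < 0) :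
    ∀ᶠ z in nhds u, ∀ c ∈ C, c ≠ 0 → c z < 0 := by
  have hK : IsCompact (C ∩ Metric.sphere 0 1) := (isCompact_sphere _ _).inter_left hC
  have := hK.eventually_forall_of_forall_eventually (x₀ := u) (P := fun z c => c z < 0)
      fun c hc => by
    refine ContinuousAt.eventually_lt (f := fun p : E × StrongDual ℝ E => p.2 p.1)
      (g := fun _ => 0) (by fun_prop) continuousAt_const (hu c hc.1 ?_)
    rintro rfl
    simp at hc
  filter_upwards [this] with z hz c hc hc0
  have hn : 0 < ‖c‖ := norm_pos_iff.2 hc0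
  have := hz (‖c‖⁻¹ • c) ⟨hcone c hc _ (inv_pos.2 hn), by simp [norm_smul, hn.ne']⟩
  simp only [smul_apply, smul_eq_mul] at this
  by_contra h
  exact absurd this (not_lt.2 (mul_nonneg (inv_pos.2 hn).le (not_lt.1 h)))

end Functionals

section Transversality

variable {E : Type*} [NormedAddCommGroup E] [NormedSpace ℝ E] {ι : Type*}

theorem maximizers_eq_self_of_forall_vectorSpan {y : StrongDual ℝ E} {T : Finset E}
    (h : ∀ w ∈ vectorSpan ℝ (T : Set E), y w = 0) : maximizers y T = T := by
  ext x
  simp only [mem_maximizers, and_iff_left_iff_imp]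
  intro hx b hb
  have := h (b -ᵥ x) (vsub_mem_vectorSpan ℝ hb hx)
  rw [vsub_eq_sub, map_sub] at this
  linarith

theorem mem_iSup_of_iSupIndep {V L : ι → Submodule ℝ E} (hV : iSupIndep V) {J : Finset ι} {z : E}
    (hL : ∀ i ∈ J, L i ≤ V i) (hz : z ∈ ⨆ i ∈ J, V i)
    (h : ∀ i ∈ J, z ∈ (⨆ (j) (_ : j ≠ i), V j) ⊔ L i) : z ∈ ⨆ i ∈ J, L i := by
  classical
  obtain ⟨μ, rfl⟩ := (Submodule.mem_iSup_finset_iff_exists_sum V z).1 hz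
  refine Submodule.sum_mem _ fun i hi => Submodule.mem_iSup_of_mem i
    (Submodule.mem_iSup_of_mem hi ?_)
  obtain ⟨w, hw, l, hl, hwl⟩ := Submodule.mem_sup.1 (h i hi)
  rw [← Finset.add_sum_erase J _ hi] at hwl
  have hsum : ∑ j ∈ J.erase i, (μ j : E) ∈ ⨆ (j) (_ : j ≠ i), V j :=
    Submodule.sum_mem _ fun j hj => Submodule.mem_iSup_of_mem j
      (Submodule.mem_iSup_of_mem (Finset.ne_of_mem_erase hj) (μ j).2)
  have hdiff : (μ i : E) - l = w - ∑ j ∈ J.erase i, (μ j : E) := by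
    rw [sub_eq_sub_iff_add_eq_add, ← hwl, add_comm]
  have h0 : (μ i : E) - l = 0 := Submodule.disjoint_def.1 (hV i) _
    ((V i).sub_mem (μ i).2 (hL i hi hl)) (hdiff ▸ Submodule.sub_mem _ hw hsum)
  rwa [sub_eq_zero.1 h0]

/-- The span of one difference of points of `S j` for each `j ∈ J`. -/
def differenceSpan (S : ι → Finset E) (J : Finset ι) (f : ∀ i, S i × S i) : Submodule ℝ E :=
  ⨆ j ∈ J, Submodule.span ℝ {((f j).1 : E) - (f j).2}

theorem finrank_differenceSpan_le [FiniteDimensional ℝ E] (S : ι → Finset E) (J : Finset ι)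
    (f : ∀ i, S i × S i) : Module.finrank ℝ (differenceSpan S J f) ≤ J.card := by
  classical
  have : differenceSpan S J f
      = Submodule.span ℝ (J.image fun j => ((f j).1 : E) - (f j).2 : Finset E) := by
    rw [differenceSpan, Finset.coe_image, Set.image_eq_iUnion, Submodule.span_iUnion₂]
    rfl
  rw [this]
  exact (finrank_span_finset_le_card _).trans Finset.card_image_le

variable [FiniteDimensional ℝ E] {S : ι → Finset E}

theorem exists_pos_direction_commonWall
    {c : StrongDual ℝ E} (hind : iSupIndep fun i => vectorSpan ℝ (maximizers c (S i) : Set E))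
    (hS : ∀ i, (S i).Nonempty) {J : Finset ι} (hcJ : c ∈ commonWall S J) {z : E}
    (hz : ∀ f, z ∉ differenceSpan S J f) :
    ∃ y : StrongDual ℝ E, 0 < y z ∧ ∀ j ∈ J, (maximizers y (maximizers c (S j))).Nontrivial := by
  set V := fun i => vectorSpan ℝ (maximizers c (S i) : Set E)
  by_cases hzV : z ∈ ⨆ i ∈ J, V i
  swap
  · obtain ⟨y, hy, hyz⟩ := exists_strongDual_eq_one_of_notMem hzV
    refine ⟨y, hyz ▸ one_pos, fun j hj => ?_⟩
    rw [maximizers_eq_self_of_forall_vectorSpan fun w hw => hy w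
      (Submodule.mem_iSup_of_mem j (Submodule.mem_iSup_of_mem hj hw))]
    exact hcJ j hj
  by_cases h : ∃ i ∈ J, ∀ a ∈ maximizers c (S i), ∀ b ∈ maximizers c (S i), a ≠ b →
      z ∉ (⨆ (j) (_ : j ≠ i), V j) ⊔ Submodule.span ℝ {a - b}
  · obtain ⟨i, hi, h⟩ := h
    obtain ⟨y, hyW, hyz, hy⟩ := exists_nontrivial_maximizers (hcJ i hi) (fun a ha b hb hab hW => by
      refine hab (sub_eq_zero.1 (Submodule.disjoint_def.1 (hind i) _ ?_ hW))
      exact vsub_mem_vectorSpan ℝ ha hb) h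
    refine ⟨y, hyz, fun j hj => ?_⟩
    rcases eq_or_ne j i with rfl | hji
    · exact hy
    · rw [maximizers_eq_self_of_forall_vectorSpan fun w hw => hyW w
        (Submodule.mem_iSup_of_mem j (Submodule.mem_iSup_of_mem hji hw))]
      exact hcJ j hj
  · push Not at h
    have : ∀ i, ∃ p : S i × S i, i ∈ J → ((p.1 : E) ∈ maximizers c (S i) ∧
        (p.2 : E) ∈ maximizers c (S i) ∧
        z ∈ (⨆ (j) (_ : j ≠ i), V j) ⊔ Submodule.span ℝ {(p.1 : E) - p.2}) := fun i => by
      by_cases hi : i ∈ J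
      · obtain ⟨a, ha, b, hb, -, hz⟩ := h i hi
        exact ⟨(⟨a, maximizers_subset _ _ ha⟩, ⟨b, maximizers_subset _ _ hb⟩),
          fun _ => ⟨ha, hb, hz⟩⟩
      · obtain ⟨a, ha⟩ := hS i
        exact ⟨(⟨a, ha⟩, ⟨a, ha⟩), fun h => absurd h hi⟩
    choose f hf using this
    refine absurd (mem_iSup_of_iSupIndep hind (fun i hi => ?_) hzV fun i hi => (hf i hi).2.2) (hz f)
    rw [Submodule.span_singleton_le_iff_mem]
    exact vsub_mem_vectorSpan ℝ (hf i hi).1 (hf i hi).2.1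

variable [Finite ι]

/-- A functional can be perturbed so that its face of the `p`-th polytope becomes a vertex, while
the other faces do not change. Different perturbations lead to different vertices. -/
theorem exists_perturbation_pair
    {c : StrongDual ℝ E} (hind : iSupIndep fun i => vectorSpan ℝ (maximizers c (S i) : Set E))
    (hS : ∀ i, (S i).Nonempty) (p : ι) :
    ∃ c₁ c₂ : StrongDual ℝ E,
      (∀ j ≠ p, maximizers c₁ (S j) = maximizers c (S j) ∧
        maximizers c₂ (S j) = maximizers c (S j)) ∧
      (maximizers c₁ (S p)).card = 1 ∧ (maximizers c₂ (S p)).card = 1 ∧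
      ((maximizers c (S p)).Nontrivial → maximizers c₁ (S p) ≠ maximizers c₂ (S p)) := by
  obtain ⟨y, hyW, hy⟩ := exists_strongDual_injOn (maximizers c (S p))
    (W := ⨆ (j) (_ : j ≠ p), vectorSpan ℝ (maximizers c (S j) : Set E)) fun a ha b hb hab hW =>
      hab (sub_eq_zero.1 (Submodule.disjoint_def.1 (hind p) _ (vsub_mem_vectorSpan ℝ ha hb) hW))
  have hne := maximizers_nonempty c (hS p)
  have hsingle : ∀ y' : StrongDual ℝ E, Set.InjOn y' (maximizers c (S p)) →
      (maximizers y' (maximizers c (S p))).card = 1 := fun y' hy' => by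
    obtain ⟨a, ha⟩ := maximizers_nonempty y' hne
    refine Finset.card_eq_one.2 ⟨a, Finset.eq_singleton_iff_unique_mem.2 ⟨ha, fun b hb => ?_⟩⟩
    exact hy' (maximizers_subset _ _ hb) (maximizers_subset _ _ ha)
      (apply_eq_of_mem_maximizers hb ha)
  have hy2 : Set.InjOn (-y) (maximizers c (S p)) := fun a ha b hb h => hy ha hb (by simpa using h)
  obtain ⟨ε, h1, h2⟩ := ((Filter.eventually_all.2 fun i =>
    eventually_maximizers_add_smul c y (S i)).and (Filter.eventually_all.2 fun i =>
      eventually_maximizers_add_smul c (-y) (S i))).exists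
  refine ⟨c + ε • y, c + ε • (-y), fun j hj => ?_, ?_, ?_, fun hnt heq => ?_⟩
  · have : ∀ w ∈ vectorSpan ℝ (maximizers c (S j) : Set E), y w = 0 := fun w hw => hyW w
      (Submodule.mem_iSup_of_mem j (Submodule.mem_iSup_of_mem hj hw))
    rw [h1, h2]
    exact ⟨maximizers_eq_self_of_forall_vectorSpan this,
      maximizers_eq_self_of_forall_vectorSpan fun w hw => by simp [this w hw]⟩
  · rw [h1]; exact hsingle y hy
  · rw [h2]; exact hsingle _ hy2
  · rw [h1, h2] at heq
    obtain ⟨a, ha⟩ := maximizers_nonempty y hne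
    have ha' := heq ▸ ha
    obtain ⟨b, hb, hba⟩ := hnt.exists_ne a
    have e1 := (mem_maximizers.1 ha).2 b hb
    have e2 := (mem_maximizers.1 ha').2 b hb
    simp only [neg_apply] at e2
    exact hba (hy hb (maximizers_subset _ _ ha) (le_antisymm e1 (by linarith)))

theorem eventually_pos_and_mem_commonWall {J : Finset ι} {c : StrongDual ℝ E}
    (hind : iSupIndep fun i => vectorSpan ℝ (maximizers c (S i) : Set E))
    (hS : ∀ i, (S i).Nonempty) (hc : c ∈ commonWall S J) {z : E}
    (hz : ∀ f, z ∉ differenceSpan S J f) (hcz : 0 ≤ c z) :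
    ∃ y : StrongDual ℝ E, ∀ᶠ ε in nhdsWithin (0 : ℝ) (Set.Ioi 0),
      0 < (c + ε • y) z ∧ c + ε • y ∈ commonWall S J ∧
        ∀ i, maximizers (c + ε • y) (S i) ⊆ maximizers c (S i) := by
  obtain ⟨y, hyz, hy⟩ := exists_pos_direction_commonWall hind hS hc hz
  refine ⟨y, ?_⟩
  filter_upwards [Filter.eventually_all.2 fun i => eventually_maximizers_add_smul c y (S i),
    self_mem_nhdsWithin] with ε hε hpos
  refine ⟨?_, fun j hj => hε j ▸ hy j hj, fun i => hε i ▸ maximizers_subset _ _⟩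
  have : 0 < ε * y z := mul_pos hpos hyz
  simpa using by linarith

end Transversality

section Existence

variable {E : Type*} [NormedAddCommGroup E] [NormedSpace ℝ E] {ι : Type*} {S : ι → Finset E}

theorem mem_commonWall_insert [DecidableEq ι] {J : Finset ι} {p : ι} {c : StrongDual ℝ E} :
    c ∈ commonWall S (insert p J) ↔ c ∈ commonWall S J ∧ (maximizers c (S p)).Nontrivial := by
  simp [commonWall, and_comm]

/-- The functionals maximizing the quotient `c u / -c z` over a cone: `c (u + ρ • z) ≤ 0` for all
members of the cone, with equality attained by a nonzero functional. -/
theorem exists_supporting_functional [FiniteDimensional ℝ E] {C : Set (StrongDual ℝ E)}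
    (hC : IsClosed C) (hcone : ∀ c ∈ C, ∀ t : ℝ, 0 < t → t • c ∈ C) {u z : E}
    (hz : ∀ c ∈ C, c ≠ 0 → c z < 0) {c₁ : StrongDual ℝ E} (hc₁ : c₁ ∈ C) (hu : 0 < c₁ u) :
    ∃ ρ : ℝ, 0 < ρ ∧ (∀ c ∈ C, c (u + ρ • z) ≤ 0) ∧ ∃ x ∈ C, 0 < x u ∧ x (u + ρ • z) = 0 := by
  have hK : IsCompact (C ∩ Metric.sphere 0 1) := (isCompact_sphere _ _).inter_left hC
  have hK0 : ∀ c ∈ C ∩ Metric.sphere (0 : StrongDual ℝ E) 1, c ≠ 0 := by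
    rintro c hc rfl
    simp at hc
  have hnorm : ∀ c ∈ C, c ≠ 0 → ‖c‖⁻¹ • c ∈ C ∩ Metric.sphere (0 : StrongDual ℝ E) 1 :=
    fun c hc hc0 => ⟨hcone c hc _ (inv_pos.2 (norm_pos_iff.2 hc0)),
      by simp [norm_smul, (norm_pos_iff.2 hc0).ne']⟩
  have hc₁0 : c₁ ≠ 0 := by rintro rfl; simp at hu
  have hcont : ContinuousOn (fun c : StrongDual ℝ E => c u / -c z) (C ∩ Metric.sphere 0 1) :=
    ContinuousOn.div (by fun_prop) (by fun_prop)
      fun c hc => neg_ne_zero.2 (hz c hc.1 (hK0 c hc)).ne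
  obtain ⟨x, hx, hmax⟩ := hK.exists_isMaxOn ⟨_, hnorm c₁ hc₁ hc₁0⟩ hcont
  have hratio : ∀ c ∈ C, c ≠ 0 → c u / -c z ≤ x u / -x z := fun c hc hc0 => by
    have h : (‖c‖⁻¹ • c) u / -(‖c‖⁻¹ • c) z ≤ x u / -x z := hmax (hnorm c hc hc0)
    rwa [smul_apply, smul_apply, ← smul_neg, smul_eq_mul, smul_eq_mul,
      mul_div_mul_left _ _ (inv_pos.2 (norm_pos_iff.2 hc0)).ne'] at h
  have hxz := hz x hx.1 (hK0 x hx)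
  have hρ : 0 < x u / -x z :=
    (div_pos hu (neg_pos.2 (hz c₁ hc₁ hc₁0))).trans_le (hratio c₁ hc₁ hc₁0)
  refine ⟨x u / -x z, hρ, fun c hc => ?_, x, hx.1, ?_, ?_⟩
  · rcases eq_or_ne c 0 with rfl | hc0
    · simp
    · have h := hratio c hc hc0
      rw [div_le_iff₀ (neg_pos.2 (hz c hc hc0))] at h
      rw [map_add, map_smul, smul_eq_mul]
      linarith
  · exact (div_pos_iff_of_pos_right (neg_pos.2 hxz)).1 hρ
  · rw [map_add, map_smul, smul_eq_mul]
    field_simp [hxz.ne]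
    ring

/-- The common wall of fewer than `dim E` polytopes meets every closed half-space nontrivially. -/
theorem exists_mem_commonWall_nonneg [FiniteDimensional ℝ E] [Finite ι]
    (hS : ∀ i, (S i).Nontrivial)
    (hind : ∀ c : StrongDual ℝ E, c ≠ 0 →
      iSupIndep fun i => vectorSpan ℝ (maximizers c (S i) : Set E))
    (J : Finset ι) (hJ : J.card < Module.finrank ℝ E) (u : E) :
    ∃ c ∈ commonWall S J, c ≠ 0 ∧ 0 ≤ c u := by
  classical
  induction J using Finset.induction_on generalizing u with
  | empty =>
    have := Module.nontrivial_of_finrank_pos (Nat.zero_lt_of_lt hJ)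
    obtain ⟨c, hc⟩ := exists_ne (0 : StrongDual ℝ E)
    rcases le_total 0 (c u) with h | h
    · exact ⟨c, by simp [commonWall], hc, h⟩
    · exact ⟨-c, by simp [commonWall], neg_ne_zero.2 hc, by simpa using h⟩
  | insert p J hp ih =>
    rw [Finset.card_insert_of_notMem hp] at hJ
    have hSn : ∀ i, (S i).Nonempty := fun i => (hS i).nonempty
    have hrank : ∀ f, Module.finrank ℝ (differenceSpan S J f) ≤ J.card :=
      finrank_differenceSpan_le S J
    by_contra! hneg
    obtain ⟨u, hugen, hu⟩ := ((frequently_forall_notMem_submodule (differenceSpan S J)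
      (fun f h => by have := hrank f; rw [h, finrank_top] at this; omega) u).and_eventually
      (eventually_forall_apply_neg (isClosed_commonWall S (insert p J))
        (fun c hc t ht => smul_mem_commonWall hc ht) hneg)).exists
    obtain ⟨c₀, hc₀, hc₀0, hc₀u⟩ := ih (by omega) u
    obtain ⟨y, hy⟩ := eventually_pos_and_mem_commonWall (hind c₀ hc₀0) hSn hc₀ hugen hc₀u
    obtain ⟨ε, hc₁u, hc₁, -⟩ := hy.exists
    set c₁ := c₀ + ε • y
    obtain ⟨v, hv⟩ := maximizers_nonempty c₁ (hSn p)
    obtain ⟨w, hw, hwv⟩ := (hS p).exists_ne v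
    set C := {c ∈ commonWall S J | 0 ≤ c u ∧ v ∈ maximizers c (S p)}
    have hCclosed : IsClosed C := (isClosed_commonWall S J).inter
      ((isClosed_le (f := fun _ => 0) (g := fun c : StrongDual ℝ E => c u) (by fun_prop)
        (by fun_prop)).inter (isClosed_setOf_mem_maximizers _ _))
    have hCcone : ∀ c ∈ C, ∀ t : ℝ, 0 < t → t • c ∈ C := fun c hc t ht =>
      ⟨smul_mem_commonWall hc.1 ht, by simpa using mul_nonneg ht.le hc.2.1,
        by rw [maximizers_smul _ _ ht]; exact hc.2.2⟩
    have hCsingle : ∀ c ∈ C, c ≠ 0 → maximizers c (S p) = {v} := fun c hc hc0 => by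
      by_contra hne
      have hnt := (Finset.nontrivial_iff_ne_singleton hc.2.2).2 hne
      exact absurd (hu c (mem_commonWall_insert.2 ⟨hc.1, hnt⟩) hc0) (not_lt.2 hc.2.1)
    have hCneg : ∀ c ∈ C, c ≠ 0 → c (w - v) < 0 := fun c hc hc0 => by
      rw [map_sub, sub_neg]
      exact apply_lt_of_maximizers_eq_singleton (hCsingle c hc hc0) hw hwv
    obtain ⟨z, hzgen, hz⟩ := ((frequently_forall_notMem_submodule
      (fun f => differenceSpan S J f ⊔ Submodule.span ℝ {u}) (fun f h => by
        have h1 := Submodule.finrank_add_le_finrank_add_finrank (differenceSpan S J f)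
          (Submodule.span ℝ {u})
        have h2 := finrank_span_le_card (R := ℝ) ({u} : Set E)
        have h3 := hrank f
        rw [h, finrank_top] at h1
        simp only [Set.toFinset_singleton, Finset.card_singleton] at h2
        omega) (w - v)).and_eventually
      (eventually_forall_apply_neg hCclosed hCcone hCneg)).exists
    obtain ⟨ρ, hρ, hle, x, hx, hxu, hxz⟩ := exists_supporting_functional hCclosed hCcone hz
      (show c₁ ∈ C from ⟨hc₁, hc₁u.le, hv⟩) hc₁u
    have hx0 : x ≠ 0 := by rintro rfl; simp at hxu
    obtain ⟨y, hy⟩ := eventually_pos_and_mem_commonWall (hind x hx0) hSn hx.1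
      (z := u + ρ • z) (fun f hf => hzgen f (by
        have : z = ρ⁻¹ • (u + ρ • z) - ρ⁻¹ • u := by
          rw [smul_add, smul_smul, inv_mul_cancel₀ hρ.ne']; simp
        rw [this]
        exact Submodule.sub_mem _ (Submodule.smul_mem _ _ (Submodule.mem_sup_left hf))
          (Submodule.smul_mem _ _ (Submodule.mem_sup_right
            (Submodule.mem_span_singleton_self u))))) hxz.ge
    have hpos : ∀ᶠ ε in nhdsWithin (0 : ℝ) (Set.Ioi 0), 0 < (x + ε • y) u :=
      nhdsWithin_le_nhds (ContinuousAt.eventually_lt continuousAt_const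
        (by simp; fun_prop) (by simpa using hxu))
    obtain ⟨ε, ⟨hεz, hεJ, hεmax⟩, hεu⟩ := (hy.and hpos).exists
    refine absurd (hle _ ⟨hεJ, hεu.le, ?_⟩) (not_le.2 hεz)
    obtain ⟨v', hv'⟩ := maximizers_nonempty (x + ε • y) (hSn p)
    have := hεmax p hv'
    rw [hCsingle x hx hx0, Finset.mem_singleton] at this
    exact this ▸ hv'

end Existence

section Counting

variable {E : Type*} [NormedAddCommGroup E] [NormedSpace ℝ E] {ι : Type*}

/-- The `i`-th face in direction `c` for `i ∈ A`, and the empty set for the other indices. -/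
noncomputable def faceTuple (S : ι → Finset E) (A : Finset ι) (c : StrongDual ℝ E) :
    ι → Finset E :=
  open Classical in fun i => if i ∈ A then maximizers c (S i) else ∅

/-- The regions into which the walls of the polytopes with index in `A` cut the common wall of the
polytopes with index in `J`. -/
def regions (S : ι → Finset E) (A J : Finset ι) : Set (ι → Finset E) :=
  faceTuple S A '' {c ∈ commonWall S J | ∀ i ∈ A, (maximizers c (S i)).card = 1}

theorem finite_regions [Finite ι] (S : ι → Finset E) (A J : Finset ι) : (regions S A J).Finite := by
  refine (Set.Finite.pi' fun i => (S i).powerset.finite_toSet).subset ?_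
  rintro _ ⟨c, -, rfl⟩ i
  simp only [faceTuple, Finset.coe_powerset]
  split_ifs
  · exact maximizers_subset _ _
  · simp

variable [FiniteDimensional ℝ E] [Finite ι] {S : ι → Finset E}

theorem two_le_ncard_regions_singleton (hS : ∀ i, (S i).Nontrivial)
    (hind : ∀ c : StrongDual ℝ E, c ≠ 0 →
      iSupIndep fun i => vectorSpan ℝ (maximizers c (S i) : Set E))
    {J : Finset ι} (hJ : J.card < Module.finrank ℝ E) {p : ι} (hp : p ∉ J) :
    2 ≤ (regions S {p} J).ncard := by
  have hSn : ∀ i, (S i).Nonempty := fun i => (hS i).nonempty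
  suffices ∃ c ∈ commonWall S J, ∃ c' ∈ commonWall S J, (maximizers c (S p)).card = 1 ∧
      (maximizers c' (S p)).card = 1 ∧ maximizers c (S p) ≠ maximizers c' (S p) by
    obtain ⟨c, hc, c', hc', h1, h2, hne⟩ := this
    refine (Set.one_lt_ncard_iff (finite_regions _ _ _)).2 ⟨faceTuple S {p} c, faceTuple S {p} c',
      ⟨c, ⟨hc, by simpa using h1⟩, rfl⟩, ⟨c', ⟨hc', by simpa using h2⟩, rfl⟩, fun h => hne ?_⟩
    simpa [faceTuple] using congrFun h p
  by_cases hnt : ∃ c ∈ commonWall S J, c ≠ 0 ∧ (maximizers c (S p)).Nontrivial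
  · obtain ⟨c, hc, hc0, hnt⟩ := hnt
    obtain ⟨c₁, c₂, h, h1, h2, hne⟩ := exists_perturbation_pair (hind c hc0) hSn p
    exact ⟨c₁, fun j hj => (h j (ne_of_mem_of_not_mem hj hp)).1 ▸ hc j hj,
      c₂, fun j hj => (h j (ne_of_mem_of_not_mem hj hp)).2 ▸ hc j hj, h1, h2, hne hnt⟩
  · push Not at hnt
    have hcard : ∀ c ∈ commonWall S J, c ≠ 0 → (maximizers c (S p)).card = 1 := fun c hc hc0 =>
      le_antisymm (Finset.card_le_one_iff_subsingleton.2
        (hnt c hc hc0)) (maximizers_nonempty c (hSn p)).card_pos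
    obtain ⟨c, hc, hc0, -⟩ := exists_mem_commonWall_nonneg hS hind J hJ 0
    obtain ⟨v, hv⟩ := Finset.card_eq_one.1 (hcard c hc hc0)
    obtain ⟨w, hw, hwv⟩ := (hS p).exists_ne v
    obtain ⟨c', hc', hc'0, hpos⟩ := exists_mem_commonWall_nonneg hS hind J hJ (w - v)
    refine ⟨c, hc, c', hc', hcard c hc hc0, hcard c' hc' hc'0, fun h => ?_⟩
    have := apply_lt_of_maximizers_eq_singleton (h ▸ hv) hw hwv
    rw [map_sub] at hpos
    linarith

theorem ncard_add_ncard_le_of_fibers {α β : Type*} {B : Set α} {X Y : Set β} (hB : B.Finite)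
    (ρ : α → β) (hYX : Y ⊆ X) (hX : ∀ τ ∈ X, ∃ s ∈ B, ρ s = τ)
    (hY : ∀ τ ∈ Y, ∃ s ∈ B, ∃ s' ∈ B, ρ s = τ ∧ ρ s' = τ ∧ s ≠ s') :
    X.ncard + Y.ncard ≤ B.ncard := by
  have hY' : ∀ τ ∈ Y, ∀ s, ∃ s' ∈ B, ρ s' = τ ∧ s' ≠ s := fun τ hτ s => by
    obtain ⟨s₁, h₁, s₂, h₂, e₁, e₂, hne⟩ := hY τ hτ
    by_cases h : s₁ = s
    · exact ⟨s₂, h₂, e₂, fun h' => hne (h.trans h'.symm)⟩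
    · exact ⟨s₁, h₁, e₁, h⟩
  rcases X.eq_empty_or_nonempty with rfl | ⟨τ₀, hτ₀⟩
  · simp [Set.subset_empty_iff.1 hYX]
  have : Nonempty α := ⟨(hX τ₀ hτ₀).choose⟩
  choose! f hfB hfρ using hX
  choose! g hgB hgρ hgne using hY'
  have hf : Set.InjOn f X := fun a ha b hb h => by rw [← hfρ a ha, h, hfρ b hb]
  have hg : Set.InjOn (fun τ => g τ (f τ)) Y := fun a ha b hb h => by
    have h : g a (f a) = g b (f b) := h
    rw [← hgρ a ha (f a), h, hgρ b hb]
  have hfX : f '' X ⊆ B := by rintro _ ⟨τ, hτ, rfl⟩; exact hfB τ hτ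
  have hgY : (fun τ => g τ (f τ)) '' Y ⊆ B := by rintro _ ⟨τ, hτ, rfl⟩; exact hgB τ hτ _
  have hdisj : Disjoint (f '' X) ((fun τ => g τ (f τ)) '' Y) := by
    rw [Set.disjoint_left]
    rintro _ ⟨a, ha, rfl⟩ ⟨b, hb, h⟩
    have hab : b = a := by rw [← hgρ b hb (f b), ← hfρ a ha]; exact congrArg ρ h
    exact hgne b hb (f b) (hab ▸ h)
  rw [← hf.ncard_image, ← hg.ncard_image,
    ← Set.ncard_union_eq hdisj (hB.subset hfX) (hB.subset hgY)]
  exact Set.ncard_le_ncard (Set.union_subset hfX hgY) hB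

theorem ncard_regions_insert [DecidableEq ι] (hS : ∀ i, (S i).Nontrivial)
    (hind : ∀ c : StrongDual ℝ E, c ≠ 0 →
      iSupIndep fun i => vectorSpan ℝ (maximizers c (S i) : Set E))
    {A J : Finset ι} (hA : A.Nonempty) {p : ι} (hpA : p ∉ A) (hpJ : p ∉ J) :
    (regions S A J).ncard + (regions S A (insert p J)).ncard
      ≤ (regions S (insert p A) J).ncard := by
  have hsplit : ∀ c ∈ commonWall S J, (∀ i ∈ A, (maximizers c (S i)).card = 1) →
      ∃ s ∈ regions S (insert p A) J, ∃ s' ∈ regions S (insert p A) J,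
        Function.update s p ∅ = faceTuple S A c ∧ Function.update s' p ∅ = faceTuple S A c ∧
        ((maximizers c (S p)).Nontrivial → s ≠ s') := fun c hc hcA => by
    have hc0 : c ≠ 0 := by
      rintro rfl
      obtain ⟨i, hi⟩ := hA
      have := hcA i hi
      rw [maximizers_zero] at this
      exact absurd (Finset.one_lt_card_iff_nontrivial.2 (hS i)) this.not_gt
    obtain ⟨c₁, c₂, h, h1, h2, hne⟩ :=
      exists_perturbation_pair (hind c hc0) (fun i => (hS i).nonempty) p
    have hmem : ∀ c' : StrongDual ℝ E, (∀ j ≠ p, maximizers c' (S j) = maximizers c (S j)) →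
        (maximizers c' (S p)).card = 1 → faceTuple S (insert p A) c' ∈ regions S (insert p A) J ∧
          Function.update (faceTuple S (insert p A) c') p ∅ = faceTuple S A c := by
      intro c' hc' hcp
      refine ⟨⟨c', ⟨fun j hj => ?_, fun i hi => ?_⟩, rfl⟩, funext fun i => ?_⟩
      · rw [hc' j (ne_of_mem_of_not_mem hj hpJ)]; exact hc j hj
      · rcases Finset.mem_insert.1 hi with rfl | hi
        · exact hcp
        · rw [hc' i (ne_of_mem_of_not_mem hi hpA)]; exact hcA i hi
      · rcases eq_or_ne i p with rfl | hip
        · simp [faceTuple, hpA]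
        · simp [faceTuple, hip, hc' i hip]
    obtain ⟨m1, e1⟩ := hmem c₁ (fun j hj => (h j hj).1) h1
    obtain ⟨m2, e2⟩ := hmem c₂ (fun j hj => (h j hj).2) h2
    refine ⟨_, m1, _, m2, e1, e2, fun hnt heq => hne hnt ?_⟩
    simpa [faceTuple] using congrFun heq p
  refine ncard_add_ncard_le_of_fibers (finite_regions _ _ _) (fun s => Function.update s p ∅)
    ?_ ?_ ?_
  · rintro _ ⟨c, hc, rfl⟩
    exact ⟨c, ⟨(mem_commonWall_insert.1 hc.1).1, hc.2⟩, rfl⟩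
  · rintro _ ⟨c, hc, rfl⟩
    obtain ⟨s, hs, -, -, e, -⟩ := hsplit c hc.1 hc.2
    exact ⟨s, hs, e⟩
  · rintro _ ⟨c, hc, rfl⟩
    obtain ⟨hcJ, hnt⟩ := mem_commonWall_insert.1 hc.1
    obtain ⟨s, hs, s', hs', e, e', hne⟩ := hsplit c hcJ hc.2
    exact ⟨s, hs, s', hs', e, e', hne hnt⟩

theorem sum_range_choose_succ (n k : ℕ) :
    ∑ j ∈ Finset.range (k + 1), (n + 1).choose j
      = ∑ j ∈ Finset.range (k + 1), n.choose j + ∑ j ∈ Finset.range k, n.choose j := by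
  rw [Finset.sum_range_succ', Finset.sum_range_succ' (fun j => n.choose j)]
  simp only [Nat.choose_succ_succ, Finset.sum_add_distrib, Nat.choose_zero_right]
  ring

theorem two_mul_sum_choose_le_ncard_regions (hS : ∀ i, (S i).Nontrivial)
    (hind : ∀ c : StrongDual ℝ E, c ≠ 0 →
      iSupIndep fun i => vectorSpan ℝ (maximizers c (S i) : Set E))
    {A : Finset ι} (hA : A.Nonempty) (J : Finset ι) (hAJ : Disjoint A J) :
    2 * ∑ j ∈ Finset.range (Module.finrank ℝ E - J.card), (A.card - 1).choose j
      ≤ (regions S A J).ncard := by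
  classical
  induction hA using Finset.Nonempty.cons_induction generalizing J with
  | singleton p =>
    rcases Nat.eq_zero_or_pos (Module.finrank ℝ E - J.card) with h | h
    · simp [h]
    · refine le_trans (le_of_eq ?_)
        (two_le_ncard_regions_singleton hS hind (by omega) (Finset.disjoint_singleton_left.1 hAJ))
      obtain ⟨k, hk⟩ := Nat.exists_eq_add_of_lt h
      rw [hk, Finset.sum_range_succ']
      simp
  | cons p A hp hA ih =>
    rw [Finset.cons_eq_insert] at hAJ ⊢
    rw [Finset.disjoint_insert_left] at hAJ
    refine le_trans ?_ (ncard_regions_insert hS hind hA hp hAJ.1)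
    have h1 := ih J hAJ.2
    have h2 := ih (insert p J) (Finset.disjoint_insert_right.2 ⟨hp, hAJ.2⟩)
    rw [Finset.card_insert_of_notMem hAJ.1] at h2
    rw [Finset.card_insert_of_notMem hp]
    obtain ⟨n, hn⟩ := Nat.exists_eq_succ_of_ne_zero hA.card_pos.ne'
    rw [hn] at h1 h2 ⊢
    rcases Nat.eq_zero_or_pos (Module.finrank ℝ E - J.card) with h | h
    · simp [h]
    · obtain ⟨k, hk⟩ := Nat.exists_eq_succ_of_ne_zero h.ne'
      rw [show Module.finrank ℝ E - (J.card + 1) = k by omega] at h2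
      rw [hk] at h1 ⊢
      simp only [Nat.succ_eq_add_one, Nat.add_sub_cancel] at h1 h2 ⊢
      rw [sum_range_choose_succ]
      omega

end Counting

section Sums

variable {E : Type*} [NormedAddCommGroup E] [NormedSpace ℝ E] {ι : Type*}

theorem apply_lt_or_mem_convexHull_maximizers (c : StrongDual ℝ E) {S : Finset E} {v y : E}
    (hv : v ∈ maximizers c S) (hy : y ∈ convexHull ℝ (S : Set E)) :
    c y < c v ∨ c y = c v ∧ y ∈ convexHull ℝ (maximizers c S : Set E) := by
  have hconv : Convex ℝ
      {y | c y < c v ∨ c y = c v ∧ y ∈ convexHull ℝ (maximizers c S : Set E)} := by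
    rintro x hx y hy a b ha hb hab
    have hxle : c x ≤ c v := hx.elim le_of_lt fun h => h.1.le
    have hyle : c y ≤ c v := hy.elim le_of_lt fun h => h.1.le
    rcases ha.eq_or_lt with rfl | ha
    · simpa [show b = 1 by linarith] using hy
    rcases hb.eq_or_lt with rfl | hb
    · simpa [show a = 1 by linarith] using hx
    simp only [Set.mem_ofPred_eq, map_add, map_smul, smul_eq_mul]
    have hv' : c v = a * c v + b * c v := by rw [← add_mul, hab, one_mul]
    rcases hx with hx | hx
    · left; nlinarith
    rcases hy with hy | hy
    · left; nlinarith
    exact Or.inr ⟨by rw [hx.1, hy.1, ← hv'],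
      convex_convexHull ℝ _ hx.2 hy.2 ha.le hb.le hab⟩
  refine convexHull_min (fun x hx => ?_) hconv hy
  have hx : x ∈ S := hx
  rcases ((mem_maximizers.1 hv).2 x hx).lt_or_eq with h | h
  · exact Or.inl h
  · exact Or.inr ⟨h, subset_convexHull ℝ _ (Finset.mem_coe.2 (mem_maximizers.2
      ⟨hx, fun z hz => h ▸ (mem_maximizers.1 hv).2 z hz⟩))⟩

theorem vectorSpan_convexHull (s : Set E) : vectorSpan ℝ (convexHull ℝ s) = vectorSpan ℝ s := by
  rw [← direction_affineSpan, affineSpan_convexHull, direction_affineSpan]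

theorem vectorSpan_sum_le [Fintype ι] (A : ι → Set E) :
    vectorSpan ℝ (∑ i, A i) ≤ ⨆ i, vectorSpan ℝ (A i) := by
  rw [vectorSpan_def, Submodule.span_le]
  rintro _ ⟨x, hx, y, hy, rfl⟩
  obtain ⟨f, hf, rfl⟩ := (Set.mem_fintype_sum _ _).1 hx
  obtain ⟨g, hg, rfl⟩ := (Set.mem_fintype_sum _ _).1 hy
  simp only [vsub_eq_sub, ← Finset.sum_sub_distrib]
  exact Submodule.sum_mem _ fun i _ => Submodule.mem_iSup_of_mem i
    (vsub_mem_vectorSpan ℝ (hf i) (hg i))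

theorem iSupIndep_of_sum_finrank_le [FiniteDimensional ℝ E] [Fintype ι] (V : ι → Submodule ℝ E)
    (h : ∑ i, Module.finrank ℝ (V i) ≤ Module.finrank ℝ ↥(⨆ i, V i)) : iSupIndep V := by
  classical
  set L : (∀ i, V i) →ₗ[ℝ] E := LinearMap.lsum ℝ (fun i => V i) ℝ fun i => (V i).subtype with hL
  have hLapp : ∀ x, L x = ∑ i, (x i : E) := fun x => by simp [hL]
  have hle : ⨆ i, V i ≤ LinearMap.range L := iSup_le fun i x hx =>
    ⟨Pi.single i ⟨x, hx⟩, by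
      rw [hLapp, Finset.sum_eq_single i (fun j _ hj => by simp [hj]) (by simp)]; simp⟩
  have hker : LinearMap.ker L = ⊥ := by
    have h1 := L.finrank_range_add_finrank_ker
    rw [Module.finrank_pi_fintype] at h1
    have h2 := Submodule.finrank_mono hle
    exact Submodule.finrank_eq_zero.1 (by omega)
  rw [iSupIndep_iff_finsetSum_eq_zero_imp_eq_zero]
  intro s v hv h0 i hi
  have hx : (fun i => if hi : i ∈ s then (⟨v i, hv i hi⟩ : V i) else 0) ∈ LinearMap.ker L := by
    rw [LinearMap.mem_ker, hLapp, ← h0, ← Finset.sum_subset (Finset.subset_univ s)]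
    · exact Finset.sum_congr rfl fun j hj => by simp [hj]
    · intro j _ hj; simp [hj]
  rw [hker, Submodule.mem_bot] at hx
  simpa [hi] using congrArg Subtype.val (congrFun hx i)

variable {S : ι → Finset E}

theorem exists_of_mem_regions_univ [Fintype ι] {τ : ι → Finset E}
    (hτ : τ ∈ regions S Finset.univ ∅) :
    ∃ c : StrongDual ℝ E, ∃ v : ι → E, (∀ i, maximizers c (S i) = {v i}) ∧ τ = fun i => {v i} := by
  obtain ⟨c, ⟨-, hc⟩, rfl⟩ := hτ
  choose v hv using fun i => Finset.card_eq_one.1 (hc i (Finset.mem_univ i))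
  exact ⟨c, v, hv, funext fun i => by simp [faceTuple, hv]⟩

theorem apply_le_and_eq_of_maximizers_eq_singleton {c : StrongDual ℝ E} {S : Finset E} {v y : E}
    (hv : maximizers c S = {v}) (hy : y ∈ convexHull ℝ (S : Set E)) :
    c y ≤ c v ∧ (c y = c v → y = v) := by
  rcases apply_lt_or_mem_convexHull_maximizers c (hv ▸ Finset.mem_singleton_self v) hy with h | h
  · exact ⟨h.le, fun h' => absurd h' h.ne⟩
  · exact ⟨h.1.le, fun _ => by simpa [hv] using h.2⟩

theorem apply_sum_le_and_eq_of_maximizers_eq_singleton [Fintype ι] {c : StrongDual ℝ E}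
    {v y : ι → E} (hv : ∀ i, maximizers c (S i) = {v i})
    (hy : ∀ i, y i ∈ convexHull ℝ (S i : Set E)) :
    c (∑ i, y i) ≤ c (∑ i, v i) ∧ (c (∑ i, v i) ≤ c (∑ i, y i) → y = v) := by
  have hle : ∀ i ∈ Finset.univ, c (y i) ≤ c (v i) := fun i _ =>
    (apply_le_and_eq_of_maximizers_eq_singleton (hv i) (hy i)).1
  simp only [map_sum]
  refine ⟨Finset.sum_le_sum hle, fun h => funext fun i => ?_⟩
  exact (apply_le_and_eq_of_maximizers_eq_singleton (hv i) (hy i)).2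
    ((Finset.sum_eq_sum_iff_of_le hle).1 ((Finset.sum_le_sum hle).antisymm h) i (Finset.mem_univ i))

theorem finite_extremePoints_sum_convexHull [Fintype ι] (S : ι → Finset E) :
    (Set.extremePoints ℝ (∑ i, convexHull ℝ (S i : Set E))).Finite := by
  rw [← convexHull_sum]
  refine Set.Finite.subset ?_ extremePoints_convexHull_subset
  classical
  rw [← Finset.coe_sum]
  exact Finset.finite_toSet _

theorem ncard_regions_le_ncard_extremePoints [Fintype ι] (S : ι → Finset E) :
    (regions S Finset.univ ∅).ncard
      ≤ (Set.extremePoints ℝ (∑ i, convexHull ℝ (S i : Set E))).ncard := by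
  have hmem : ∀ {c : StrongDual ℝ E} {v : ι → E}, (∀ i, maximizers c (S i) = {v i}) →
      ∀ i, v i ∈ convexHull ℝ (S i : Set E) := fun {c v} hv i =>
    subset_convexHull ℝ _ (Finset.mem_coe.2
      (maximizers_subset c (S i) (hv i ▸ Finset.mem_singleton_self (v i))))
  refine Set.ncard_le_ncard_of_injOn (fun τ => ∑ i, ∑ x ∈ τ i, x) ?_ ?_
    (finite_extremePoints_sum_convexHull S)
  · intro τ hτ
    obtain ⟨c, v, hv, rfl⟩ := exists_of_mem_regions_univ hτ
    simp only [Finset.sum_singleton]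
    refine exposedPoints_subset_extremePoints
      ⟨(Set.mem_fintype_sum _ _).2 ⟨v, hmem hv, rfl⟩, c, fun y hy => ?_⟩
    obtain ⟨y, hyS, rfl⟩ := (Set.mem_fintype_sum _ _).1 hy
    obtain ⟨h1, h2⟩ := apply_sum_le_and_eq_of_maximizers_eq_singleton hv hyS
    exact ⟨h1, fun h => by rw [h2 h]⟩
  · intro τ hτ τ' hτ' h
    obtain ⟨c, v, hv, rfl⟩ := exists_of_mem_regions_univ hτ
    obtain ⟨c', v', hv', rfl⟩ := exists_of_mem_regions_univ hτ'
    simp only [Finset.sum_singleton] at h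
    rw [(apply_sum_le_and_eq_of_maximizers_eq_singleton hv (hmem hv')).2 (by rw [h])]

end Sums

theorem face_convexHull {d : ℕ} (c : (Fin d → ℝ) →ₗ[ℝ] ℝ) {S : Finset (Fin d → ℝ)}
    (hS : S.Nonempty) : face c (convexHull ℝ (S : Set (Fin d → ℝ)))
      = convexHull ℝ (maximizers (LinearMap.toContinuousLinearMap c) S : Set (Fin d → ℝ)) := by
  obtain ⟨v, hv⟩ := maximizers_nonempty (LinearMap.toContinuousLinearMap c) hS
  have hvS : v ∈ convexHull ℝ (S : Set (Fin d → ℝ)) :=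
    subset_convexHull ℝ _ (Finset.mem_coe.2 (maximizers_subset _ _ hv))
  have key := fun y hy => apply_lt_or_mem_convexHull_maximizers _ (y := y) hv hy
  ext x
  constructor
  · rintro ⟨hx, hmax⟩
    exact (key x hx).elim (fun h => absurd (hmax v hvS) (not_le.2 h)) fun h => h.2
  · intro hx
    refine ⟨convexHull_mono (Finset.coe_subset.2 (maximizers_subset _ _)) hx, fun y hy => ?_⟩
    have hxv : c x = c v := by
      refine convexHull_min (t := {z | c z = c v}) (fun z hz => ?_) ?_ hx
      · exact apply_eq_of_mem_maximizers (Finset.mem_coe.1 hz) hv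
      · exact convex_hyperplane c.isLinear _
    rw [hxv]
    exact (key y hy).elim le_of_lt fun h => h.1.le

theorem polyDim_convexHull {d : ℕ} (s : Set (Fin d → ℝ)) :
    polyDim (convexHull ℝ s) = Module.finrank ℝ (vectorSpan ℝ s) := by
  rw [polyDim, vectorSpan_convexHull]

theorem iSupIndep_vectorSpan_maximizers {d m : ℕ} {S : Fin m → Finset (Fin d → ℝ)}
    (hS : ∀ i, (S i).Nonempty)
    (hgen : InGeneralPosition fun i => convexHull ℝ (S i : Set (Fin d → ℝ)))
    {c : StrongDual ℝ (Fin d → ℝ)} (hc : c ≠ 0) :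
    iSupIndep fun i => vectorSpan ℝ (maximizers c (S i) : Set (Fin d → ℝ)) := by
  have h := hgen (c : (Fin d → ℝ) →ₗ[ℝ] ℝ) fun h => hc (ContinuousLinearMap.coe_injective h)
  have hface : ∀ i, face (c : (Fin d → ℝ) →ₗ[ℝ] ℝ) (convexHull ℝ (S i : Set (Fin d → ℝ)))
      = convexHull ℝ (maximizers c (S i) : Set (Fin d → ℝ)) := fun i => face_convexHull _ (hS i)
  simp only [hface, polyDim_convexHull] at h
  rw [polyDim] at h
  refine iSupIndep_of_sum_finrank_le _ (h.symm.le.trans (Submodule.finrank_mono ?_))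
  simpa only [vectorSpan_convexHull] using vectorSpan_sum_le fun i =>
    convexHull ℝ (maximizers c (S i) : Set (Fin d → ℝ))

theorem nontrivial_of_one_le_polyDim_convexHull {d : ℕ} {S : Finset (Fin d → ℝ)}
    (h : 1 ≤ polyDim (convexHull ℝ (S : Set (Fin d → ℝ)))) : S.Nontrivial := by
  by_contra hS
  have hsub : (S : Set (Fin d → ℝ)).Subsingleton := Set.not_nontrivial_iff.1 hS
  rw [polyDim_convexHull, vectorSpan_of_subsingleton ℝ hsub, finrank_bot] at h
  omega

theorem minkowski_sum_lower_bound_theorem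
    (d m : ℕ) (hd : 1 ≤ d) (hm : 1 ≤ m)
    (P : Fin m → Set (Fin d → ℝ))
    (hpoly : ∀ i, IsPolytope (P i))
    (hdim : ∀ i, 1 ≤ polyDim (P i))
    (hgen : InGeneralPosition P) :
    2 * ∑ k ∈ Finset.range d, (m - 1).choose k
      ≤ Nat.card (Set.extremePoints ℝ (∑ i, P i)) := by
  choose S hSn hP using hpoly
  obtain rfl : P = fun i => convexHull ℝ (S i : Set (Fin d → ℝ)) := funext hP
  have : Nonempty (Fin m) := ⟨⟨0, hm⟩⟩
  have h := two_mul_sum_choose_le_ncard_regions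
    (fun i => nontrivial_of_one_le_polyDim_convexHull (hdim i))
    (fun c hc => iSupIndep_vectorSpan_maximizers hSn hgen hc)
    (Finset.univ_nonempty (α := Fin m)) ∅ (Finset.disjoint_empty_right _)
  simp only [Module.finrank_fin_fun, Finset.card_empty, Nat.sub_zero, Finset.card_univ,
    Fintype.card_fin] at h
  exact h.trans (ncard_regions_le_ncard_extremePoints S)
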